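/- Let M← be the set of right-continuous nondecreasing functions from [0,1] to the Cantor set C, endowed with the metric δ(f,g) = ∫₀¹|f(a)−g(a)| da, and let Γ be the set of all nonempty δ-closed subsets of M←, endowed with the Hausdorff metric. If a sequence U_n ∈ Γ converges to U ∈ Γ in the Hausdorff metric, then the pointwise infima inf U_n converge to inf U in the metric δ. In particular, the map U ↦ inf U from Γ to (M←, δ) is continuous. -/

import Mathlib

open MeasureTheory Topology Filter
open scoped ENNReal

/-- Lebesgue measure on the unit interval `[0,1]`. -/
noncomputable def lebI : Measure unitInterval := (volume : Measure ℝ).comap Subtype.val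

/-- The set `M←` of right-continuous nondecreasing functions from `[0,1]` to the
Cantor set `C`. -/
def Mleft : Set (unitInterval → ℝ) :=
  {f | Monotone f ∧ (∀ a, f a ∈ cantorSet) ∧ ∀ a, ContinuousWithinAt f (Set.Ici a) a}

/-- The metric `δ(f,g) = ∫₀¹ |f a − g a| da`. -/
noncomputable def delta (f g : unitInterval → ℝ) : ℝ := ∫ a, |f a - g a| ∂lebI

/-- The pointwise infimum `a ↦ inf {h a : h ∈ U}` of a set of functions. -/
noncomputable def infFun (U : Set (unitInterval → ℝ)) : unitInterval → ℝ :=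
  fun a => sInf ((fun h => h a) '' U)

/-- A set `U` is δ-closed (in `M←`): it contains every member of `M←` at
δ-distance zero from `U`. -/
def DeltaClosed (U : Set (unitInterval → ℝ)) : Prop :=
  ∀ f ∈ Mleft, (∀ ε : ℝ, 0 < ε → ∃ g ∈ U, delta f g < ε) → f ∈ U

/-- The Hausdorff distance between subsets of `M←` induced by the metric `δ`. -/
noncomputable def hDist (U V : Set (unitInterval → ℝ)) : ℝ≥0∞ :=
  max (⨆ f ∈ U, ⨅ g ∈ V, ENNReal.ofReal (delta f g))
      (⨆ g ∈ V, ⨅ f ∈ U, ENNReal.ofReal (delta f g))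

/-- The real-line integral computing `delta`, via constant extension to `ℝ`. -/
lemma delta_eq_integral_IccExtend (f g : unitInterval → ℝ) :
    delta f g = ∫ x in (0 : ℝ)..1,
      |Set.IccExtend zero_le_one f x - Set.IccExtend zero_le_one g x| := by
  have h := integral_subtype_comap (μ := (volume : Measure ℝ))
    (measurableSet_Icc : MeasurableSet (Set.Icc (0 : ℝ) 1))
    (fun x => |Set.IccExtend zero_le_one f x - Set.IccExtend zero_le_one g x|)
  simp only [Set.IccExtend_val] at h
  rw [intervalIntegral.integral_of_le zero_le_one, ← integral_Icc_eq_integral_Ioc, ← h]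
  rfl

lemma Monotone.intervalIntegrable_abs_sub {F G : ℝ → ℝ} (hF : Monotone F) (hG : Monotone G)
    (a b : ℝ) : IntervalIntegrable (fun x => |F x - G x|) volume a b :=
  (hF.intervalIntegrable.sub hG.intervalIntegrable).abs

/-- Monotone functions that are close in `L¹` are close in the sense of Lévy. -/
lemma Monotone.sub_le_of_integral_abs_sub_lt {F G : ℝ → ℝ} (hF : Monotone F) (hG : Monotone G)
    {s a : ℝ} (hs : 0 ≤ s) (hsa : s ≤ a) (ha : a ≤ 1)
    (h : ∫ x in (0 : ℝ)..1, |F x - G x| < s ^ 2) : G (a - s) - s ≤ F a := by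
  by_contra! hlt
  have h₁ : ∫ _ in (a - s)..a, s ≤ ∫ x in (a - s)..a, |F x - G x| := by
    refine intervalIntegral.integral_mono_on (by linarith) (by simp)
      (hF.intervalIntegrable_abs_sub hG _ _) fun x hx => ?_
    have hFx := hF hx.2
    have hGx := hG hx.1
    rw [abs_sub_comm]
    exact le_trans (by linarith) (le_abs_self _)
  have h₂ : ∫ x in (a - s)..a, |F x - G x| ≤ ∫ x in (0 : ℝ)..1, |F x - G x| :=
    intervalIntegral.integral_mono_interval (by linarith) (by linarith) ha
      (Eventually.of_forall fun _ => abs_nonneg _) (hF.intervalIntegrable_abs_sub hG _ _)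
  rw [intervalIntegral.integral_const, smul_eq_mul] at h₁
  nlinarith

/-- The increments of step `s` of a `[0,1]`-valued monotone function integrate to at most `s`. -/
lemma Monotone.integral_sub_comp_sub_le {F : ℝ → ℝ} (hF : Monotone F)
    (hF₀ : ∀ x, 0 ≤ F x) (hF₁ : ∀ x, F x ≤ 1) {s : ℝ} (hs : 0 ≤ s) :
    ∫ x in s..1, (F x - F (x - s)) ≤ s := by
  have hi : ∀ a b, IntervalIntegrable F volume a b := fun _ _ => hF.intervalIntegrable
  have hshift : Monotone fun x => F (x - s) := fun x y h => hF (by linarith)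
  rw [intervalIntegral.integral_sub (hi _ _) hshift.intervalIntegrable,
    intervalIntegral.integral_comp_sub_right, sub_self]
  have e₁ := intervalIntegral.integral_add_adjacent_intervals (hi 0 s) (hi s 1)
  have e₂ := intervalIntegral.integral_add_adjacent_intervals (hi 0 (1 - s)) (hi (1 - s) 1)
  have h₀ : 0 ≤ ∫ x in (0 : ℝ)..s, F x :=
    intervalIntegral.integral_nonneg hs fun x _ => hF₀ x
  have h₁ : ∫ x in (1 - s)..1, F x ≤ ∫ _ in (1 - s)..1, (1 : ℝ) :=
    intervalIntegral.integral_mono_on (by linarith) (hi _ _) (by simp) fun x _ => hF₁ x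
  rw [intervalIntegral.integral_const, smul_eq_mul] at h₁
  linarith

/-- `[0,1]`-valued monotone functions that are close in the sense of Lévy are close in `L¹`. -/
lemma Monotone.integral_abs_sub_le {F G : ℝ → ℝ} (hF : Monotone F) (hG : Monotone G)
    (hF₀ : ∀ x, 0 ≤ F x) (hF₁ : ∀ x, F x ≤ 1) (hG₀ : ∀ x, 0 ≤ G x) (hG₁ : ∀ x, G x ≤ 1)
    {s : ℝ} (hs : 0 ≤ s) (hs₁ : s ≤ 1)
    (hGF : ∀ a, s ≤ a → a ≤ 1 → G (a - s) - s ≤ F a)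
    (hFG : ∀ a, s ≤ a → a ≤ 1 → F (a - s) - s ≤ G a) :
    ∫ x in (0 : ℝ)..1, |F x - G x| ≤ 5 * s := by
  have hi := hF.intervalIntegrable_abs_sub hG
  have hFs : Monotone fun x => F (x - s) := fun x y h => hF (by linarith)
  have hGs : Monotone fun x => G (x - s) := fun x y h => hG (by linarith)
  have iF : IntervalIntegrable (fun x => F x - F (x - s)) volume s 1 :=
    hF.intervalIntegrable.sub hFs.intervalIntegrable
  have iG : IntervalIntegrable (fun x => G x - G (x - s)) volume s 1 :=
    hG.intervalIntegrable.sub hGs.intervalIntegrable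
  have ic : IntervalIntegrable (fun _ => s) volume s 1 := by simp
  rw [← intervalIntegral.integral_add_adjacent_intervals (hi 0 s) (hi s 1)]
  have h₁ : ∫ x in (0 : ℝ)..s, |F x - G x| ≤ ∫ _ in (0 : ℝ)..s, (1 : ℝ) := by
    refine intervalIntegral.integral_mono_on hs (hi _ _) (by simp) fun x _ => ?_
    have := hF₀ x; have := hF₁ x; have := hG₀ x; have := hG₁ x
    exact abs_le.2 ⟨by linarith, by linarith⟩
  have h₂ : ∫ x in s..1, |F x - G x| ≤
      ∫ x in s..1, ((F x - F (x - s)) + (G x - G (x - s)) + s) := by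
    refine intervalIntegral.integral_mono_on hs₁ (hi _ _) ((iF.add iG).add ic) fun x hx => ?_
    have := hGF x hx.1 hx.2
    have := hFG x hx.1 hx.2
    have := hF (sub_le_self x hs)
    have := hG (sub_le_self x hs)
    exact abs_le.2 ⟨by linarith, by linarith⟩
  rw [intervalIntegral.integral_add (iF.add iG) ic, intervalIntegral.integral_add iF iG] at h₂
  have h₃ := hF.integral_sub_comp_sub_le hF₀ hF₁ hs
  have h₄ := hG.integral_sub_comp_sub_le hG₀ hG₁ hs
  rw [intervalIntegral.integral_const, smul_eq_mul] at h₁ h₂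
  nlinarith

lemma mem_Icc_of_mem_Mleft {f : unitInterval → ℝ} (hf : f ∈ Mleft) (a : unitInterval) :
    f a ∈ Set.Icc (0 : ℝ) 1 :=
  cantorSet_subset_unitInterval (hf.2.1 a)

lemma infFun_le {W : Set (unitInterval → ℝ)} (hW : W ⊆ Mleft) {f : unitInterval → ℝ}
    (hf : f ∈ W) (a : unitInterval) : infFun W a ≤ f a :=
  csInf_le ⟨0, by rintro _ ⟨h, hh, rfl⟩; exact (mem_Icc_of_mem_Mleft (hW hh) a).1⟩
    (Set.mem_image_of_mem _ hf)

lemma le_infFun {W : Set (unitInterval → ℝ)} (hne : W.Nonempty) {a : unitInterval} {c : ℝ}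
    (h : ∀ f ∈ W, c ≤ f a) : c ≤ infFun W a :=
  le_csInf (hne.image _) (by rintro _ ⟨f, hf, rfl⟩; exact h f hf)

lemma monotone_infFun {W : Set (unitInterval → ℝ)} (hne : W.Nonempty) (hW : W ⊆ Mleft) :
    Monotone (infFun W) := fun a _ hab =>
  le_infFun hne fun _ hf => (infFun_le hW hf a).trans ((hW hf).1 hab)

lemma infFun_mem_Icc {W : Set (unitInterval → ℝ)} (hne : W.Nonempty) (hW : W ⊆ Mleft)
    (a : unitInterval) : infFun W a ∈ Set.Icc (0 : ℝ) 1 := by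
  refine ⟨le_infFun hne fun f hf => (mem_Icc_of_mem_Mleft (hW hf) a).1, ?_⟩
  obtain ⟨f, hf⟩ := hne
  exact (infFun_le hW hf a).trans (mem_Icc_of_mem_Mleft (hW hf) a).2

lemma exists_delta_lt_of_iSup_iInf_lt {W W' : Set (unitInterval → ℝ)} {r : ℝ}
    {d : (unitInterval → ℝ) → (unitInterval → ℝ) → ℝ}
    (h : ⨆ f ∈ W, ⨅ g ∈ W', ENNReal.ofReal (d f g) < ENNReal.ofReal r)
    {f : unitInterval → ℝ} (hf : f ∈ W) : ∃ g ∈ W', d f g < r := by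
  have h' := (le_iSup₂
    (f := fun f (_ : f ∈ W) => ⨅ g ∈ W', ENNReal.ofReal (d f g)) f hf).trans_lt h
  simp only [iInf_lt_iff] at h'
  obtain ⟨g, hg, hlt⟩ := h'
  exact ⟨g, hg, (ENNReal.ofReal_lt_ofReal_iff'.1 hlt).1⟩

lemma delta_comm (f g : unitInterval → ℝ) : delta f g = delta g f := by
  simp only [delta, abs_sub_comm]

/-- If every member of `W` is `L¹`-close to a member of `W'`, then the infimum of `W` is bounded
below, up to a shift in both variables, by that of `W'`. -/
lemma IccExtend_infFun_sub_le {W W' : Set (unitInterval → ℝ)} (hne : W.Nonempty)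
    (hW : W ⊆ Mleft) (hW' : W' ⊆ Mleft) {s : ℝ} (hs : 0 ≤ s)
    (h : ∀ f ∈ W, ∃ g ∈ W', delta f g < s ^ 2) (a : ℝ) (hsa : s ≤ a) (ha : a ≤ 1) :
    Set.IccExtend zero_le_one (infFun W') (a - s) - s ≤
      Set.IccExtend zero_le_one (infFun W) a := by
  refine le_infFun hne fun f hf => ?_
  obtain ⟨g, hg, hfg⟩ := h f hf
  rw [delta_eq_integral_IccExtend] at hfg
  have hle := ((hW hf).1.IccExtend zero_le_one).sub_le_of_integral_abs_sub_lt
    ((hW' hg).1.IccExtend zero_le_one) hs hsa ha hfg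
  have hinf : Set.IccExtend zero_le_one (infFun W') (a - s) ≤
      Set.IccExtend zero_le_one g (a - s) := infFun_le hW' hg _
  exact (sub_le_sub_right hinf s).trans hle

lemma delta_infFun_le {W W' : Set (unitInterval → ℝ)} (hne : W.Nonempty) (hne' : W'.Nonempty)
    (hW : W ⊆ Mleft) (hW' : W' ⊆ Mleft) {s : ℝ} (hs : 0 ≤ s) (hs₁ : s ≤ 1)
    (h : hDist W W' < ENNReal.ofReal (s ^ 2)) : delta (infFun W) (infFun W') ≤ 5 * s := by
  obtain ⟨h₁, h₂⟩ := max_lt_iff.1 h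
  rw [delta_eq_integral_IccExtend]
  refine ((monotone_infFun hne hW).IccExtend zero_le_one).integral_abs_sub_le
    ((monotone_infFun hne' hW').IccExtend zero_le_one)
    (fun _ => (infFun_mem_Icc hne hW _).1) (fun _ => (infFun_mem_Icc hne hW _).2)
    (fun _ => (infFun_mem_Icc hne' hW' _).1) (fun _ => (infFun_mem_Icc hne' hW' _).2) hs hs₁
    (IccExtend_infFun_sub_le hne hW hW' hs fun f hf => exists_delta_lt_of_iSup_iInf_lt h₁ hf)
    (IccExtend_infFun_sub_le hne' hW' hW hs fun g hg => ?_)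
  obtain ⟨f, hf, hlt⟩ := exists_delta_lt_of_iSup_iInf_lt (d := fun g f => delta f g) h₂ hg
  exact ⟨f, hf, delta_comm g f ▸ hlt⟩

/-- If a sequence `U n` of nonempty δ-closed subsets of `M←` converges to a nonempty
δ-closed `V ⊆ M←` in the Hausdorff metric, then `inf (U n)` converges to `inf V` in
the metric `δ`; in particular `U ↦ inf U` is continuous on `Γ`. -/
theorem stmt6 (U : ℕ → Set (unitInterval → ℝ)) (V : Set (unitInterval → ℝ))
    (hUne : ∀ n, (U n).Nonempty) (hUM : ∀ n, U n ⊆ Mleft)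
    (hUclosed : ∀ n, DeltaClosed (U n))
    (hVne : V.Nonempty) (hVM : V ⊆ Mleft) (hVclosed : DeltaClosed V)
    (hconv : Tendsto (fun n => hDist (U n) V) atTop (𝓝 0)) :
    Tendsto (fun n => delta (infFun (U n)) (infFun V)) atTop (𝓝 (0 : ℝ)) ∧
    ∀ W : Set (unitInterval → ℝ), W.Nonempty → W ⊆ Mleft → DeltaClosed W →
      ∀ ε : ℝ, 0 < ε → ∃ η : ℝ, 0 < η ∧
        ∀ W' : Set (unitInterval → ℝ), W'.Nonempty → W' ⊆ Mleft → DeltaClosed W' →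
          hDist W' W < ENNReal.ofReal η → delta (infFun W') (infFun W) < ε := by
  have key : ∀ ε : ℝ, 0 < ε → ∃ η : ℝ, 0 < η ∧
      ∀ W W' : Set (unitInterval → ℝ), W.Nonempty → W ⊆ Mleft → W'.Nonempty → W' ⊆ Mleft →
        hDist W' W < ENNReal.ofReal η → delta (infFun W') (infFun W) < ε := by
    intro ε hε
    have hs : 0 < min (ε / 6) 1 := by positivity
    refine ⟨min (ε / 6) 1 ^ 2, by positivity, fun W W' hne hW hne' hW' h => ?_⟩
    have hle := delta_infFun_le hne' hne hW' hW hs.le (min_le_right _ _) h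
    linarith [min_le_left (ε / 6) 1]
  refine ⟨Metric.tendsto_nhds.2 fun ε hε => ?_, fun W hne hW _ ε hε => ?_⟩
  · obtain ⟨η, hη, h⟩ := key ε hε
    filter_upwards [hconv.eventually_lt_const (ENNReal.ofReal_pos.2 hη)] with n hn
    have hnonneg : 0 ≤ delta (infFun (U n)) (infFun V) := integral_nonneg fun _ => abs_nonneg _
    rw [Real.dist_0_eq_abs, abs_of_nonneg hnonneg]
    exact h V (U n) hVne hVM (hUne n) (hUM n) hn
  · obtain ⟨η, hη, h⟩ := key ε hε
    exact ⟨η, hη, fun W' hne' hW' _ => h W W' hne hW hne' hW'⟩
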